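/- arXiv:2201.06175 — 3 statements merged into one kernel-verified Lean document; each statement's English description precedes it below -/
import Mathlib

section
/- Let F be a field of characteristic different from 2 and n ≥ 1. Let E be the subgroup of SL_n(F) consisting of all diagonal matrices with diagonal entries in {1, −1} and determinant 1. Then |E| = 2^{n−1}, and every elementary abelian 2-subgroup of SL_n(F) is conjugate in SL_n(F) to a subgroup of E. -/
lemma common_eig_span (F : Type*) [Field F] (h2 : (2:F) ≠ 0) (n : ℕ)
    (H : Subgroup (Matrix.SpecialLinearGroup (Fin n) F)) (hH : ∀ x ∈ H, x ^ 2 = 1) :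
    ⊤ ≤ Submodule.span F {v : Fin n → F | ∀ x ∈ H,
      (x : Matrix (Fin n) (Fin n) F).mulVec v = v ∨
      (x : Matrix (Fin n) (Fin n) F).mulVec v = -v} := by
  classical
  let f : H → Module.End F (Fin n → F) := fun x => Matrix.toLin' (x.1 : Matrix (Fin n) (Fin n) F)
  have hsq : ∀ x : H, f x * f x = 1 := by
    intro x
    have h := hH x.1 x.2
    have h' : (x.1 : Matrix (Fin n) (Fin n) F) * (x.1 : Matrix (Fin n) (Fin n) F) = 1 := by
      rw [← Matrix.SpecialLinearGroup.coe_mul, ← pow_two, h, Matrix.SpecialLinearGroup.coe_one]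
    change Matrix.toLin' _ ∘ₗ Matrix.toLin' _ = _
    rw [← Matrix.toLin'_mul, h', Matrix.toLin'_one]; rfl
  have hcomm : Pairwise fun i j => Commute (f i) (f j) := by
    intro x y _
    have hxy : x * y = y * x := by
      have hx : x * x = 1 := by ext1; simpa [pow_two] using hH x.1 x.2
      have hy : y * y = 1 := by ext1; simpa [pow_two] using hH y.1 y.2
      have hz : (x * y) * (x * y) = 1 := by
        ext1; simpa [pow_two] using hH (x * y).1 (x * y).2
      have e1 := inv_eq_of_mul_eq_one_left hx
      have e2 := inv_eq_of_mul_eq_one_left hy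
      have e3 := inv_eq_of_mul_eq_one_left hz
      rw [← e3, mul_inv_rev, e1, e2]
    change Matrix.toLin' _ ∘ₗ Matrix.toLin' _ = Matrix.toLin' _ ∘ₗ Matrix.toLin' _
    rw [← Matrix.toLin'_mul, ← Matrix.toLin'_mul, ← Matrix.SpecialLinearGroup.coe_mul,
      ← Matrix.SpecialLinearGroup.coe_mul]
    have := congrArg Subtype.val hxy
    simp only [Subgroup.coe_mul] at this
    rw [this]
  have hss : ∀ x, (f x).IsSemisimple := by
    intro x
    refine Module.End.isSemisimple_of_squarefree_aeval_eq_zero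
      (p := Polynomial.X ^ 2 - Polynomial.C 1) ?_ ?_
    · exact (Polynomial.separable_X_pow_sub_C (1:F) (by exact_mod_cast h2) one_ne_zero).squarefree
    · simp [pow_two, hsq]
  have hgen : ∀ x μ, (f x).maxGenEigenspace μ = (f x).eigenspace μ := fun x μ =>
    (hss x).isFinitelySemisimple.maxGenEigenspace_eq_eigenspace μ
  have hff : ∀ x v, f x (f x v) = v := fun x v => by
    have := congrArg (fun g => g v) (hsq x)
    simpa using this
  have htop : ∀ x, ⨆ μ, (f x).maxGenEigenspace μ = ⊤ := by
    intro x
    simp only [hgen]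
    rw [eq_top_iff]
    intro v _
    have hv : v = (2:F)⁻¹ • (v + f x v) + (2:F)⁻¹ • (v - f x v) := by
      rw [← smul_add]
      have : v + f x v + (v - f x v) = (2:F) • v := by rw [two_smul]; abel
      rw [this, smul_smul, inv_mul_cancel₀ h2, one_smul]
    rw [hv]
    refine Submodule.add_mem _ (Submodule.smul_mem _ _ ?_) (Submodule.smul_mem _ _ ?_)
    · refine Submodule.mem_iSup_of_mem 1 ?_
      rw [Module.End.mem_eigenspace_iff, map_add, hff, one_smul, add_comm]
    · refine Submodule.mem_iSup_of_mem (-1) ?_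
      rw [Module.End.mem_eigenspace_iff, map_sub, hff, neg_one_smul, neg_sub]
  have key := Module.End.iSup_iInf_maxGenEigenspace_eq_top_of_iSup_maxGenEigenspace_eq_top_of_commute
    f hcomm htop
  rw [← key]
  refine iSup_le fun χ => ?_
  intro v hv
  refine Submodule.subset_span ?_
  intro x hx
  have hv' := (Submodule.mem_iInf _).1 hv ⟨x, hx⟩
  rw [hgen, Module.End.mem_eigenspace_iff] at hv'
  set μ := χ ⟨x, hx⟩
  have h3 := hff ⟨x, hx⟩ v
  rw [hv', map_smul, hv', smul_smul] at h3
  have hv2 : (x : Matrix (Fin n) (Fin n) F).mulVec v = μ • v := by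
    simpa [f] using hv'
  rw [hv2]
  by_cases h0 : v = 0
  · simp [h0]
  · have : μ * μ = 1 := by
      have : (μ * μ - 1) • v = 0 := by rw [sub_smul, h3, one_smul, sub_self]
      rcases smul_eq_zero.1 this with h | h
      · exact sub_eq_zero.1 h
      · exact absurd h h0
    rcases mul_self_eq_one_iff.1 this with h | h
    · left; rw [h, one_smul]
    · right; rw [h, neg_one_smul]

lemma conj_part (F : Type*) [Field F] (h2 : (2:F) ≠ 0) (n : ℕ) (hn : 1 ≤ n)
    (H : Subgroup (Matrix.SpecialLinearGroup (Fin n) F)) (hH : ∀ x ∈ H, x ^ 2 = 1) :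
    ∃ g : Matrix.SpecialLinearGroup (Fin n) F, ∀ x ∈ H, ∃ d : Fin n → F,
      (∀ i, d i = 1 ∨ d i = -1) ∧
      ((g * x * g⁻¹ : Matrix.SpecialLinearGroup (Fin n) F) : Matrix (Fin n) (Fin n) F)
        = Matrix.diagonal d := by
  classical
  have hspan := common_eig_span F h2 n H hH
  let b0 := Module.Basis.ofSpan hspan
  have hb0 : ∀ i, b0 i ∈ {v : Fin n → F | ∀ x ∈ H,
      (x : Matrix (Fin n) (Fin n) F).mulVec v = v ∨
      (x : Matrix (Fin n) (Fin n) F).mulVec v = -v} := fun i =>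
    Module.Basis.ofSpan_subset hspan ⟨i, rfl⟩
  let e := b0.indexEquiv (Pi.basisFun F (Fin n))
  let b := b0.reindex e
  have hb : ∀ i, ∀ x ∈ H, (x : Matrix (Fin n) (Fin n) F).mulVec (b i) = b i ∨
      (x : Matrix (Fin n) (Fin n) F).mulVec (b i) = - b i := fun i => by
    have := hb0 (e.symm i)
    simpa [b] using this
  let P : Matrix (Fin n) (Fin n) F := (Pi.basisFun F (Fin n)).toMatrix b
  have hPcol : ∀ i j, P i j = b j i := fun i j => by simp [P, Module.Basis.toMatrix_apply]
  have hPdet : P.det ≠ 0 := by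
    have h : P * b.toMatrix (Pi.basisFun F (Fin n)) = 1 :=
      Module.Basis.toMatrix_mul_toMatrix_flip _ _
    intro h0
    have := congrArg Matrix.det h
    rw [Matrix.det_mul, h0, zero_mul, Matrix.det_one] at this
    exact zero_ne_one this
  let i0 : Fin n := ⟨0, hn⟩
  let C : Matrix (Fin n) (Fin n) F := Matrix.diagonal (Function.update 1 i0 P.det⁻¹)
  have hC : C.det = P.det⁻¹ := by
    simp [C, Matrix.det_diagonal, Finset.prod_update_of_mem]
  let Q : Matrix.SpecialLinearGroup (Fin n) F :=
    ⟨P * C, by rw [Matrix.det_mul, hC, mul_inv_cancel₀ hPdet]⟩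
  refine ⟨Q⁻¹, fun x hx => ?_⟩
  have hd : ∀ i, ∃ c : F, (c = 1 ∨ c = -1) ∧
      (x : Matrix (Fin n) (Fin n) F).mulVec (b i) = c • b i := by
    intro i
    rcases hb i x hx with h | h
    · exact ⟨1, Or.inl rfl, by rw [h, one_smul]⟩
    · exact ⟨-1, Or.inr rfl, by rw [h, neg_one_smul]⟩
  choose d hd1 hd2 using hd
  refine ⟨d, hd1, ?_⟩
  have hxP : (x : Matrix (Fin n) (Fin n) F) * P = P * Matrix.diagonal d := by
    ext i j
    rw [Matrix.mul_diagonal, Matrix.mul_apply]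
    have := congrFun (hd2 j) i
    simp only [Matrix.mulVec, dotProduct, Pi.smul_apply, smul_eq_mul] at this
    simp only [hPcol]
    rw [this, mul_comm]
  have hxQ : (x : Matrix (Fin n) (Fin n) F) * (Q : Matrix (Fin n) (Fin n) F)
      = (Q : Matrix (Fin n) (Fin n) F) * Matrix.diagonal d := by
    change (x : Matrix (Fin n) (Fin n) F) * (P * C) = P * C * Matrix.diagonal d
    rw [← mul_assoc, hxP, mul_assoc, mul_assoc, Matrix.diagonal_mul_diagonal,
      Matrix.diagonal_mul_diagonal]
    simp only [mul_comm]
  rw [inv_inv, mul_assoc, Matrix.SpecialLinearGroup.coe_mul, Matrix.SpecialLinearGroup.coe_mul,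
    hxQ, ← mul_assoc, ← Matrix.SpecialLinearGroup.coe_mul, inv_mul_cancel,
    Matrix.SpecialLinearGroup.coe_one, one_mul]

lemma card_part (F : Type*) [Field F] (h2 : (2:F) ≠ 0) (m : ℕ)
    (E : Subgroup (Matrix.SpecialLinearGroup (Fin (m+1)) F))
    (hE : ∀ A, A ∈ E ↔ ∃ d : Fin (m+1) → F, (∀ i, d i = 1 ∨ d i = -1) ∧
      (A : Matrix (Fin (m+1)) (Fin (m+1)) F) = Matrix.diagonal d) :
    Nat.card E = 2 ^ m := by
  classical
  have hne : (1:F) ≠ -1 := by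
    intro h
    apply h2
    linear_combination h
  let c : ℤˣ → F := fun u => ((u : ℤ) : F)
  have hc : ∀ u, c u = 1 ∨ c u = -1 := by
    intro u
    rcases Int.units_eq_one_or u with h | h <;> simp [c, h]
  have hcinj : Function.Injective c := by
    intro u v h
    rcases Int.units_eq_one_or u with hu | hu <;> rcases Int.units_eq_one_or v with hv | hv <;>
      simp_all [c]
  have hcsurj : ∀ a : F, a = 1 ∨ a = -1 → ∃ u, c u = a := by
    rintro a (h | h)
    · exact ⟨1, by simp [c, h]⟩
    · exact ⟨-1, by simp [c, h]⟩
  have hprod : ∀ s : Fin m → ℤˣ, ∏ i, c (s i) = c (∏ i, s i) := by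
    intro s; simp [c, Units.coe_prod]
  have hcsq : ∀ u, c u * c u = 1 := by
    intro u; rcases hc u with h | h <;> simp [h]
  let D : (Fin m → ℤˣ) → (Fin (m+1) → F) := fun s => Fin.cons (c (∏ i, s i)) (fun i => c (s i))
  let f : (Fin m → ℤˣ) → E := fun s => ⟨⟨Matrix.diagonal (D s), by
      rw [Matrix.det_diagonal, Fin.prod_univ_succ]
      simp only [D, Fin.cons_zero, Fin.cons_succ]
      rw [hprod, hcsq]⟩, (hE _).2 ⟨D s, by
      intro i
      refine Fin.cases ?_ (fun j => ?_) i
      · exact hc _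
      · exact hc _, rfl⟩⟩
  have hf : Function.Bijective f := by
    constructor
    · intro s t h
      have h1 : Matrix.diagonal (D s) = Matrix.diagonal (D t) :=
        congrArg (fun A : E => (A.1 : Matrix (Fin (m+1)) (Fin (m+1)) F)) h
      have h3 := Matrix.diagonal_injective h1
      funext i
      exact hcinj (by simpa [D] using congrFun h3 i.succ)
    · rintro ⟨A, hA⟩
      obtain ⟨d, hd, hAd⟩ := (hE A).1 hA
      choose u hu using fun i => hcsurj (d i) (hd i)
      have hdet := A.2
      rw [hAd, Matrix.det_diagonal, Fin.prod_univ_succ] at hdet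
      simp only [← hu] at hdet
      rw [hprod] at hdet
      refine ⟨fun i => u i.succ, ?_⟩
      apply Subtype.ext
      apply Subtype.ext
      change Matrix.diagonal _ = (A : Matrix (Fin (m+1)) (Fin (m+1)) F)
      rw [hAd]
      congr 1
      funext i
      refine Fin.cases ?_ (fun j => ?_) i
      · change c _ = _
        rw [← hu]
        have := hcsq (u 0)
        exact mul_left_cancel₀ (left_ne_zero_of_mul_eq_one this) (hdet.trans this.symm)
      · exact hu _
  rw [← Nat.card_eq_of_bijective f hf]
  simp


/-- Let `F` be a field of characteristic `≠ 2` and `n ≥ 1`. Let `E ≤ SL_n(F)` be the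
subgroup of diagonal matrices with entries in `{1, -1}` (and determinant 1). Then
`|E| = 2^(n-1)` and every elementary abelian 2-subgroup of `SL_n(F)` is conjugate
to a subgroup of `E`. -/
theorem stmt7 (F : Type*) [Field F] (hchar : ringChar F ≠ 2) (n : ℕ) (hn : 1 ≤ n)
    (E : Subgroup (Matrix.SpecialLinearGroup (Fin n) F))
    (hE : ∀ A, A ∈ E ↔ ∃ d : Fin n → F, (∀ i, d i = 1 ∨ d i = -1) ∧
      (A : Matrix (Fin n) (Fin n) F) = Matrix.diagonal d) :
    Nat.card E = 2 ^ (n - 1) ∧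
    ∀ H : Subgroup (Matrix.SpecialLinearGroup (Fin n) F), (∀ x ∈ H, x ^ 2 = 1) →
      ∃ g : Matrix.SpecialLinearGroup (Fin n) F, ∀ x ∈ H, g * x * g⁻¹ ∈ E := by
  have h2 : (2:F) ≠ 0 := Ring.two_ne_zero hchar
  constructor
  · obtain ⟨m, rfl⟩ : ∃ m, n = m + 1 := ⟨n - 1, by omega⟩
    simpa using card_part F h2 m E hE
  · intro H hH
    obtain ⟨g, hg⟩ := conj_part F h2 n hn H hH
    exact ⟨g, fun x hx => (hE _).2 (hg x hx)⟩
end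

section
/- Let q be an odd prime power. Then a Sylow 2-subgroup of SL_2(q) is a generalized quaternion group of order (q² − 1)_2, where (q² − 1)_2 denotes the 2-part of q² − 1. -/
open Matrix in
lemma card_SL2 (F : Type*) [Field F] [Fintype F] [DecidableEq F] :
    Nat.card (SpecialLinearGroup (Fin 2) F) = Fintype.card F * (Fintype.card F ^ 2 - 1) := by
  have h1 := Matrix.card_GL_field (𝔽 := F) 2
  have hq : 1 < Fintype.card F := Fintype.one_lt_card
  have e : Nat.card (SpecialLinearGroup (Fin 2) F) =
      Nat.card (GeneralLinearGroup.det (n := Fin 2) (R := F)).ker := by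
    refine Nat.card_congr (Equiv.ofBijective
      (fun g => ⟨SpecialLinearGroup.toGL g, ?_⟩) ⟨?_, ?_⟩)
    · rw [MonoidHom.mem_ker]; ext; simp
    · intro g g' h
      exact SpecialLinearGroup.toGL_injective (Subtype.ext_iff.1 h)
    · rintro ⟨g, hg⟩
      refine ⟨⟨(g : Matrix (Fin 2) (Fin 2) F), ?_⟩, ?_⟩
      · have := congrArg Units.val (MonoidHom.mem_ker.1 hg)
        simpa using this
      · apply Subtype.ext; ext; rfl
  have h2 := Subgroup.card_mul_index (GeneralLinearGroup.det (n := Fin 2) (R := F)).ker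
  rw [Subgroup.index_ker, MonoidHom.range_eq_top.2 GeneralLinearGroup.det_surjective, h1, ← e,
    Subgroup.card_top, Nat.card_eq_fintype_card (α := Fˣ), Fintype.card_units] at h2
  simp [Fin.prod_univ_two] at h2
  generalize Fintype.card F = q at *
  obtain ⟨r, rfl⟩ : ∃ r, q = r + 1 := ⟨q - 1, by omega⟩
  simp only [Nat.add_sub_cancel] at h2
  have : (r+1)^2 - (r+1) = r * (r+1) := by
    rw [Nat.sub_eq_iff_eq_add (by nlinarith)]; ring
  rw [this] at h2
  apply Nat.eq_of_mul_eq_mul_right (show 0 < r by omega)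
  rw [Nat.card_eq_fintype_card, h2]; ring

open QuaternionGroup in
lemma quat_embed {G : Type*} [Group G] (n : ℕ) (A B : G) (hA : orderOf A = 2 * n)
    (hB : B * B = A ^ n) (hBA : A * B = B * A⁻¹) (hne : A * A ≠ 1) :
    ∃ f : QuaternionGroup n →* G, Function.Injective f := by
  let e : ZMod (2 * n) →+ Additive G := ZMod.lift (2 * n)
    ⟨zmultiplesHom (Additive G) (Additive.ofMul A), by
      simp only [zmultiplesHom_apply, natCast_zsmul, ← ofMul_pow, ← hA, pow_orderOf_eq_one]; rfl⟩
  let E : ZMod (2 * n) → G := fun i => (e i).toMul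
  have Ez : ∀ z : ℤ, E (z : ZMod (2 * n)) = A ^ z := fun z => by
    simp only [E, e, ZMod.lift_coe]; rfl
  have Eadd : ∀ i j, E (i + j) = E i * E j := fun i j => by simp [E]
  have En : E (n : ZMod (2 * n)) = A ^ n := by
    have := Ez n
    simpa using this
  have Einj : ∀ i, E i = 1 → i = 0 := by
    intro i
    obtain ⟨z, rfl⟩ := ZMod.intCast_surjective i
    rw [Ez, ← orderOf_dvd_iff_zpow_eq_one, hA]
    exact (ZMod.intCast_zmod_eq_zero_iff_dvd z (2 * n)).2
  have Einj2 : ∀ i j, E i = E j → i = j := by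
    intro i j h
    have h0 : E (i - j) * E j = E j := by rw [← Eadd, sub_add_cancel, h]
    exact sub_eq_zero.1 (Einj _ (by simpa using h0))
  have Ecomm : ∀ i, E i * B = B * E (-i) := by
    intro i
    obtain ⟨z, rfl⟩ := ZMod.intCast_surjective i
    rw [← Int.cast_neg, Ez, Ez]
    have : SemiconjBy B A⁻¹ A := hBA.symm
    have := this.zpow_right z
    rw [inv_zpow'] at this
    exact this.eq.symm
  have E0 : E 0 = 1 := by simp [E]
  let g : QuaternionGroup n → G := fun x => match x with
    | a i => E i
    | xa i => B * E i
  refine ⟨MonoidHom.mk' g ?_, ?_⟩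
  · rintro (i | i) (j | j)
    · exact Eadd i j
    · change B * E (j - i) = E i * (B * E j)
      rw [← mul_assoc, Ecomm, mul_assoc, ← Eadd]; congr 2; ring
    · change B * E (i + j) = B * E i * E j
      rw [Eadd, mul_assoc]
    · change E (n + j - i) = B * E i * (B * E j)
      rw [mul_assoc, ← mul_assoc (E i), Ecomm, mul_assoc, ← mul_assoc B, hB, ← En, ← Eadd, ← Eadd]
      congr 1; ring
  · have key : ∀ i j, B * E i ≠ E j := by
      intro i j h
      have hB' : B = E (j - i) := by
        rw [eq_comm, ← mul_left_inj (E i), ← Eadd, h]; simp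
      have : B * A = A * B := by
        have hA1 : A = E ((1 : ℤ) : ZMod (2 * n)) := by rw [Ez]; simp
        rw [hB', hA1, ← Eadd, ← Eadd, add_comm]
      rw [hBA, mul_right_inj] at this
      exact hne (by nth_rewrite 1 [this]; simp)
    rintro (i | i) (j | j) h
    · rw [Einj2 i j h]
    · exact (key j i h.symm).elim
    · exact (key i j h).elim
    · have h' : B * E i = B * E j := h
      rw [Einj2 i j (mul_left_cancel h')]

lemma mem_of_pow_card {F K : Type*} [Field F] [Fintype F] [Field K] [Algebra F K] (t : K)
    (ht : t ^ Fintype.card F = t) : ∃ s : F, algebraMap F K s = t := by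
  classical
  have hq : 1 < Fintype.card F := Fintype.one_lt_card
  by_contra! hcon
  have hne := FiniteField.X_pow_card_sub_X_ne_zero K hq
  have hsub : insert t (Finset.univ.image (algebraMap F K)) ⊆
      (Polynomial.X ^ Fintype.card F - Polynomial.X : Polynomial K).roots.toFinset := by
    intro x hx
    rw [Multiset.mem_toFinset, Polynomial.mem_roots hne]
    rcases Finset.mem_insert.1 hx with rfl | hx
    · simp [ht]
    · obtain ⟨y, -, rfl⟩ := Finset.mem_image.1 hx
      simp [← map_pow, FiniteField.pow_card]
  have h1 := Finset.card_le_card hsub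
  rw [Finset.card_insert_of_notMem (by simpa using hcon),
    Finset.card_image_of_injective _ (algebraMap F K).injective] at h1
  have h2 := (Multiset.toFinset_card_le _).trans (Polynomial.card_roots' 
    (Polynomial.X ^ Fintype.card F - Polynomial.X : Polynomial K))
  rw [FiniteField.X_pow_card_sub_X_natDegree_eq K hq] at h2
  simp at h1
  omega

open Matrix in
lemma companion_pow {K : Type*} [Field K] (z : K) (hz : z ≠ 0) (hz2 : z ≠ z⁻¹) (n : ℕ)
    (hn : z ^ n = -1) : (!![0, -1; 1, z + z⁻¹] : Matrix (Fin 2) (Fin 2) K) ^ n = -1 := by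
  have hs : SemiconjBy (!![1, 1; -z, -z⁻¹] : Matrix (Fin 2) (Fin 2) K) (diagonal ![z, z⁻¹])
      !![0, -1; 1, z + z⁻¹] := by
    unfold SemiconjBy
    ext i j
    fin_cases i <;> fin_cases j <;> simp [Matrix.mul_apply, Fin.sum_univ_two, diagonal] <;>
      field_simp <;> ring
  have h2 := (hs.pow_right n).eq
  have hD : (diagonal ![z, z⁻¹] : Matrix (Fin 2) (Fin 2) K) ^ n = -1 := by
    rw [diagonal_pow]
    ext i j
    fin_cases i <;> fin_cases j <;> simp [diagonal, hn, inv_neg]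
  rw [hD] at h2
  have hu : IsUnit (!![1, 1; -z, -z⁻¹] : Matrix (Fin 2) (Fin 2) K) := by
    rw [Matrix.isUnit_iff_isUnit_det, det_fin_two_of, isUnit_iff_ne_zero]
    intro h
    apply hz2
    linear_combination h
  apply hu.mul_right_cancel
  rw [← h2]; simp

lemma exists_conic {F : Type*} [Field F] [Fintype F] (hq : Fintype.card F % 2 = 1) (t : F)
    (h2 : (2 : F) ≠ 0) (ht : t ^ 2 - 4 ≠ 0) : ∃ x y : F, x ^ 2 - t * x * y + y ^ 2 = -1 := by
  have h4 : (4 : F) ≠ 0 := by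
    have : (4 : F) = 2 * 2 := by norm_num
    rw [this]; exact mul_ne_zero h2 h2
  obtain ⟨u, y, h⟩ := FiniteField.exists_root_sum_quadratic
    (f := Polynomial.C 1 * Polynomial.X ^ 2 + Polynomial.C 0 * Polynomial.X + Polynomial.C (1 : F))
    (g := Polynomial.C (-(t ^ 2 - 4) / 4) * Polynomial.X ^ 2 + Polynomial.C 0 * Polynomial.X
      + Polynomial.C (0 : F))
    (Polynomial.degree_quadratic one_ne_zero)
    (Polynomial.degree_quadratic (div_ne_zero (neg_ne_zero.2 ht) h4)) hq
  simp at h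
  refine ⟨u + t * y / 2, y, ?_⟩
  field_simp at h ⊢
  linear_combination h

open Matrix in
lemma quat_in_SL2 {F : Type*} [Field F] [Fintype F] [DecidableEq F] (m : ℕ)
    (hq : Fintype.card F % 2 = 1)
    (hd : 2 ^ (m + 2) ∣ Fintype.card F - 1 ∨ 2 ^ (m + 2) ∣ Fintype.card F + 1) :
    ∃ f : QuaternionGroup (2 ^ (m + 1)) →* SpecialLinearGroup (Fin 2) F,
      Function.Injective f := by
  have hcard : 1 < Fintype.card F := Fintype.one_lt_card
  have h2 : (2 : F) ≠ 0 := by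
    apply Ring.two_ne_zero
    intro h
    have := (FiniteField.even_card_iff_char_two (F := F)).1 h
    omega
  let K := AlgebraicClosure F
  have h2K : (2 : K) ≠ 0 := by
    have := (map_ne_zero (algebraMap F K)).2 h2
    rwa [map_ofNat] at this
  have hneg : (-1 : K) ≠ 1 := by
    intro h; apply h2K; linear_combination -h
  obtain ⟨z, hz⟩ := IsAlgClosed.exists_pow_nat_eq (-1 : K) (n := 2 ^ (m + 1)) (by positivity)
  have hz0 : z ≠ 0 := by
    rintro rfl
    rw [zero_pow (by positivity)] at hz
    exact one_ne_zero (α := K) (by linear_combination hz)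
  have hzz : z ^ (2 ^ (m + 2)) = 1 := by
    rw [pow_succ 2 (m + 1), pow_mul, hz]; norm_num
  have hzi : z ≠ z⁻¹ := by
    intro h
    have hs : z ^ 2 = 1 := by rw [sq]; nth_rewrite 1 [h]; exact inv_mul_cancel₀ hz0
    rw [pow_succ', pow_mul, hs, one_pow] at hz
    exact hneg hz.symm
  have htq : (z + z⁻¹) ^ Fintype.card F = z + z⁻¹ := by
    obtain ⟨p, hp⟩ := CharP.exists F
    have := hp
    obtain ⟨k, hpp, hk⟩ := FiniteField.card F p
    have : Fact p.Prime := ⟨hpp⟩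
    have : CharP K p := charP_of_injective_algebraMap (algebraMap F K).injective p
    have hadd : (z + z⁻¹) ^ Fintype.card F = z ^ Fintype.card F + (z ^ Fintype.card F)⁻¹ := by
      rw [hk, add_pow_char_pow, inv_pow]
    rw [hadd]
    rcases hd with ⟨c, hc⟩ | ⟨c, hc⟩
    · have : z ^ Fintype.card F = z := by
        rw [show Fintype.card F = 2 ^ (m + 2) * c + 1 by omega, pow_succ, pow_mul, hzz]; simp
      rw [this]
    · have : z ^ Fintype.card F = z⁻¹ := by
        apply eq_inv_of_mul_eq_one_left
        rw [← pow_succ, hc, pow_mul, hzz, one_pow]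
      rw [this, inv_inv, add_comm]
  obtain ⟨t, ht⟩ := mem_of_pow_card (F := F) (z + z⁻¹) htq
  have ht4 : t ^ 2 - 4 ≠ 0 := by
    intro h
    have h' := congrArg (algebraMap F K) h
    rw [map_sub, map_pow, ht, map_ofNat, map_zero] at h'
    apply hzi
    have h3 : (z - z⁻¹) ^ 2 = 0 := by
      have := mul_inv_cancel₀ hz0
      linear_combination h' - 4 * this
    exact sub_eq_zero.1 (pow_eq_zero_iff (two_ne_zero)|>.1 h3)
  obtain ⟨x, y, hxy⟩ := exists_conic hq t h2 ht4
  let A : SpecialLinearGroup (Fin 2) F := ⟨!![0, -1; 1, t], by simp [det_fin_two_of]⟩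
  let B : SpecialLinearGroup (Fin 2) F := ⟨!![x, y; y - t * x, -x], by
    rw [det_fin_two_of]; linear_combination -hxy⟩
  have hAn : A ^ (2 ^ (m + 1)) = -1 := by
    apply Subtype.ext
    have hinj : Function.Injective ((algebraMap F K).mapMatrix (m := Fin 2)) :=
      Matrix.map_injective (algebraMap F K).injective
    apply hinj
    have hA : (algebraMap F K).mapMatrix (A : Matrix (Fin 2) (Fin 2) F)
        = !![0, -1; 1, z + z⁻¹] := by
      ext i j
      fin_cases i <;> fin_cases j <;> simp [A, ht]
    have := companion_pow z hz0 hzi _ hz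
    rw [← hA, ← map_pow] at this
    refine Eq.trans ?_ (this.trans ?_)
    · rfl
    · rw [← map_one ((algebraMap F K).mapMatrix (m := Fin 2)), ← map_neg]
      rfl
  have hne1 : (-1 : SpecialLinearGroup (Fin 2) F) ≠ 1 := by
    intro h
    have := congrArg (fun g : SpecialLinearGroup (Fin 2) F => g.1 0 0) h
    simp at this
    apply h2
    linear_combination -this
  refine quat_embed (2 ^ (m + 1)) A B ?_ ?_ ?_ ?_
  · rw [← pow_succ']
    apply orderOf_eq_prime_pow
    · rw [hAn]; exact hne1
    · rw [pow_succ 2 (m + 1), pow_mul, hAn]; simp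
  · rw [hAn]
    ext i j
    change ((!![x, y; y - t * x, -x] * !![x, y; y - t * x, -x] : Matrix (Fin 2) (Fin 2) F)) i j
      = (-1 : Matrix (Fin 2) (Fin 2) F) i j
    fin_cases i <;> fin_cases j <;> simp [Matrix.mul_apply, Fin.sum_univ_two]
    · linear_combination hxy
    · ring
    · ring
    · linear_combination hxy
  · ext i j
    change ((!![0, -1; 1, t] * !![x, y; y - t * x, -x] : Matrix (Fin 2) (Fin 2) F)) i j
      = ((!![x, y; y - t * x, -x] * adjugate !![0, -1; 1, t] : Matrix (Fin 2) (Fin 2) F)) i j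
    fin_cases i <;> fin_cases j <;> simp [Matrix.mul_apply, Fin.sum_univ_two, adjugate_fin_two]
    all_goals ring
  · intro h
    rw [pow_succ', pow_mul, sq, h, one_pow] at hAn
    exact hne1 hAn.symm

lemma arith (q : ℕ) (hq : q % 2 = 1) (hq1 : 1 < q) : ∃ m, (q ^ 2 - 1).factorization 2 = m + 3 ∧
    (2 ^ (m + 2) ∣ q - 1 ∨ 2 ^ (m + 2) ∣ q + 1) := by
  obtain ⟨r, rfl⟩ : ∃ r, q = 2 * r + 1 := ⟨q / 2, by omega⟩
  have e : (2 * r + 1) ^ 2 - 1 = 4 * (r * (r + 1)) := by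
    rw [Nat.sub_eq_iff_eq_add (by nlinarith)]; ring
  have h0 : (2 * r + 1) ^ 2 - 1 ≠ 0 := by
    rw [e]; have : 0 < r := by omega
    positivity
  have h3 : 3 ≤ ((2 * r + 1) ^ 2 - 1).factorization 2 := by
    rw [← Nat.prime_two.pow_dvd_iff_le_factorization h0, e]
    obtain ⟨c, hc⟩ := (Nat.even_mul_succ_self r).two_dvd
    exact ⟨c, by rw [hc]; ring⟩
  obtain ⟨m, hm⟩ := Nat.exists_eq_add_of_le' h3
  refine ⟨m, hm, ?_⟩
  have hd : 2 ^ (m + 3) ∣ (2 * r + 1) ^ 2 - 1 := by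
    rw [← hm]; exact Nat.ordProj_dvd _ _
  rw [e, show 2 ^ (m + 3) = 4 * 2 ^ (m + 1) by ring] at hd
  have hd := Nat.dvd_of_mul_dvd_mul_left (by norm_num) hd
  rcases Nat.even_or_odd r with hr | hr
  · left
    have : Nat.Coprime (2 ^ (m + 1)) (r + 1) :=
      Nat.Coprime.pow_left _ (Nat.coprime_two_left.2 hr.add_one)
    obtain ⟨c, hc⟩ := this.dvd_of_dvd_mul_right hd
    exact ⟨c, by rw [pow_succ]; simp; rw [mul_right_comm, ← hc]; ring⟩
  · right
    have : Nat.Coprime (2 ^ (m + 1)) r :=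
      Nat.Coprime.pow_left _ (Nat.coprime_two_left.2 hr)
    obtain ⟨c, hc⟩ := this.dvd_of_dvd_mul_left hd
    exact ⟨c, by rw [pow_succ, mul_right_comm, ← hc]; ring⟩

/-- Let `q` be an odd prime power. A Sylow 2-subgroup of `SL_2(q)` is generalized
quaternion of order `(q²-1)_2` (the 2-part of `q²-1`). -/
theorem stmt12 (p k : ℕ) (hp : p.Prime) (hpodd : Odd p) (hk : 0 < k)
    (q : ℕ) (hq : q = p ^ k)
    (F : Type*) [Field F] [Fintype F] [DecidableEq F] (hF : Fintype.card F = q)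
    (P : Sylow 2 (Matrix.SpecialLinearGroup (Fin 2) F)) :
    Nat.card (P : Subgroup (Matrix.SpecialLinearGroup (Fin 2) F)) =
      2 ^ ((q ^ 2 - 1).factorization 2) ∧
    Nonempty ((P : Subgroup (Matrix.SpecialLinearGroup (Fin 2) F)) ≃*
      QuaternionGroup (2 ^ ((q ^ 2 - 1).factorization 2 - 2))) := by
  have hodd : Odd q := hq ▸ hpodd.pow
  have hq2 : q % 2 = 1 := Nat.odd_iff.1 hodd
  have hq1 : 1 < q := hF ▸ Fintype.one_lt_card
  obtain ⟨m, hm, hd⟩ := arith q hq2 hq1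
  have hfac : (Nat.card (Matrix.SpecialLinearGroup (Fin 2) F)).factorization 2
      = (q ^ 2 - 1).factorization 2 := by
    rw [card_SL2, hF, Nat.factorization_mul (by omega) (by have : 1 < q ^ 2 := by nlinarith
                                                           omega)]
    simp [Nat.factorization_eq_zero_of_not_dvd (show ¬ 2 ∣ q by omega)]
  refine ⟨by rw [← hfac]; exact P.card_eq_multiplicity, ?_⟩
  obtain ⟨f, hf⟩ := quat_in_SL2 (F := F) m (hF ▸ hq2) (hF ▸ hd)
  have hcard : Nat.card f.range
      = 2 ^ (Nat.card (Matrix.SpecialLinearGroup (Fin 2) F)).factorization 2 := by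
    rw [hfac, hm, ← Nat.card_congr (MonoidHom.ofInjective hf).toEquiv, Nat.card_eq_fintype_card,
      QuaternionGroup.card]
    ring
  rw [hm, show m + 3 - 2 = m + 1 by omega]
  exact ⟨(P.equiv (Sylow.ofCard f.range hcard)).trans (MonoidHom.ofInjective hf).symm⟩
end

section
/- Let q be an odd prime power. Then a Sylow 2-subgroup of PSL_2(q) is dihedral of order (q² − 1)_2 / 2. -/
namespace PSLDih
open Matrix

theorem dihedral_embed {G : Type*} [Group G] (N : ℕ) (α β : G) (hα : orderOf α = N)
    (hβ : β * β = 1) (hc : β * α * β = α⁻¹) (hn : ∀ m : ℤ, β * α ^ m ≠ 1) :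
    ∃ f : DihedralGroup N →* G, Function.Injective f := by
  have hαN : α ^ N = 1 := hα ▸ pow_orderOf_eq_one α
  let φ : ZMod N →+ Additive G :=
    ZMod.lift N ⟨zmultiplesHom (Additive G) (Additive.ofMul α), by
      simp [← ofMul_pow, hαN]⟩
  let ψ : ZMod N → G := fun i => (φ i).toMul
  have hψ : ∀ m : ℤ, ψ (m : ZMod N) = α ^ m := by
    intro m
    simp [ψ, φ]
  have hadd : ∀ i j, ψ (i + j) = ψ i * ψ j := by
    intro i j; simp [ψ]
  have hβi : β⁻¹ = β := inv_eq_of_mul_eq_one_left hβ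
  have hcm : ∀ m : ℤ, β * α ^ m * β = α ^ (-m) := by
    intro m
    have : (MulAut.conj β) (α ^ m) = ((MulAut.conj β) α) ^ m := map_zpow _ _ _
    simp only [MulAut.conj_apply, hβi] at this
    rw [this, hc, _root_.inv_zpow, _root_.zpow_neg]
  have hcψ : ∀ i, ψ i * β = β * ψ (-i) := by
    intro i
    obtain ⟨m, rfl⟩ := ZMod.intCast_surjective i
    rw [← Int.cast_neg, hψ, hψ, ← hcm m, ← mul_assoc, ← mul_assoc, hβ, one_mul]
  have h0 : ψ 0 = 1 := by simp [ψ]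
  let f : DihedralGroup N →* G := 
    { toFun := fun x => match x with
        | DihedralGroup.r i => ψ i
        | DihedralGroup.sr i => β * ψ i
      map_one' := by
        rw [DihedralGroup.one_def]; exact h0
      map_mul' := by
        rintro (i | i) (j | j)
        · simp [hadd]
        · simp only [DihedralGroup.r_mul_sr]
          rw [← mul_assoc, hcψ, mul_assoc, ← hadd]; congr 2; ring
        · simp [hadd, mul_assoc]
        · simp only [DihedralGroup.sr_mul_sr]
          rw [mul_assoc, ← mul_assoc (ψ i), hcψ, ← mul_assoc, ← mul_assoc, hβ, one_mul, ← hadd]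
          congr 1; ring }
  refine ⟨f, (injective_iff_map_eq_one f).2 ?_⟩
  rintro (i | i) h
  · obtain ⟨m, rfl⟩ := ZMod.intCast_surjective i
    have h : ψ m = 1 := h
    rw [hψ] at h
    rw [DihedralGroup.one_def]
    congr 1
    rw [ZMod.intCast_zmod_eq_zero_iff_dvd, ← hα]
    exact orderOf_dvd_iff_zpow_eq_one.2 h
  · obtain ⟨m, rfl⟩ := ZMod.intCast_surjective i
    have h : β * ψ m = 1 := h
    rw [hψ] at h
    exact absurd h (hn m)

theorem card_SL2 (F : Type*) [Field F] [Fintype F] [DecidableEq F] :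
    Nat.card (SpecialLinearGroup (Fin 2) F) = Fintype.card F * (Fintype.card F ^ 2 - 1) := by
  have h1 := card_GL_field (𝔽 := F) 2
  have hs : Function.Surjective (GeneralLinearGroup.det : GL (Fin 2) F →* Fˣ) := by
    intro u
    refine ⟨GeneralLinearGroup.mkOfDetNeZero !![(u:F), 0; 0, 1] (by simp), ?_⟩
    ext
    simp [GeneralLinearGroup.mkOfDetNeZero]
  have h2 := Subgroup.card_mul_index (GeneralLinearGroup.det : GL (Fin 2) F →* Fˣ).ker
  rw [Subgroup.index_ker, MonoidHom.range_eq_top.2 hs, Subgroup.card_top, h1] at h2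
  have e : Nat.card (SpecialLinearGroup (Fin 2) F) =
      Nat.card (GeneralLinearGroup.det : GL (Fin 2) F →* Fˣ).ker := by
    refine Nat.card_congr (Equiv.ofBijective (fun A => ⟨SpecialLinearGroup.toGL A, ?_⟩) ⟨?_, ?_⟩)
    · rw [MonoidHom.mem_ker]; ext; simp
    · intro A B h
      have := congrArg (fun x => (x.1 : Matrix (Fin 2) (Fin 2) F)) h
      exact Subtype.ext this
    · rintro ⟨A, hA⟩
      refine ⟨⟨A.1, ?_⟩, ?_⟩
      · exact congrArg Units.val hA
      · apply Subtype.ext; ext; rfl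
  rw [← e, Nat.card_units, Nat.card_eq_fintype_card (α := F), Fin.prod_univ_two] at h2
  have hq : 1 < Fintype.card F := Fintype.one_lt_card
  generalize Fintype.card F = q at *
  apply Nat.eq_of_mul_eq_mul_right (m := q - 1) (by omega)
  rw [h2]
  obtain ⟨r, rfl⟩ : ∃ r, q = r + 1 := ⟨q - 1, by omega⟩
  have : (r+1)^2 - (r+1) = (r+1)*r := by
    rw [Nat.sub_eq_iff_eq_add (by nlinarith)]; ring
  simp [this]; ring

theorem card_center (F : Type*) [Field F] [Fintype F] [DecidableEq F] (h2 : (2:F) ≠ 0) :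
    Nat.card (Subgroup.center (SpecialLinearGroup (Fin 2) F)) = 2 := by
  rw [Nat.card_congr (SpecialLinearGroup.center_equiv_rootsOfUnity' (0 : Fin 2)).toEquiv]
  simp only [Fintype.card_fin]
  have : IsPrimitiveRoot (-1 : F) 2 := by
    apply IsPrimitiveRoot.mk_of_lt _ (by norm_num) (by norm_num)
    intro l hl hl2
    obtain rfl : l = 1 := by omega
    intro h
    apply h2
    linear_combination -h
  exact this.card_rootsOfUnity

theorem card_PSL2 (F : Type*) [Field F] [Fintype F] [DecidableEq F] (h2 : (2:F) ≠ 0)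
    (hodd : Odd (Fintype.card F)) (n : ℕ) (hn : (Fintype.card F ^ 2 - 1).factorization 2 = n) :
    (Nat.card (SpecialLinearGroup (Fin 2) F ⧸
      Subgroup.center (SpecialLinearGroup (Fin 2) F))).factorization 2 = n - 1 := by
  have h := Subgroup.card_eq_card_quotient_mul_card_subgroup
    (Subgroup.center (SpecialLinearGroup (Fin 2) F))
  rw [card_center F h2, card_SL2] at h
  have h' : (_ : ℕ).factorization 2 = (_ : ℕ).factorization 2 := congrArg (fun x => x.factorization 2) h
  have hq : 1 < Fintype.card F := Fintype.one_lt_card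
  have hq2 : 1 < Fintype.card F ^ 2 := Nat.one_lt_pow (by norm_num) hq
  rw [Nat.factorization_mul (by omega) (by omega),
    Nat.factorization_mul Nat.card_pos.ne' (by norm_num)] at h'
  have : (Fintype.card F).factorization 2 = 0 :=
    Nat.factorization_eq_zero_of_not_dvd (by rwa [← even_iff_two_dvd, Nat.not_even_iff_odd])
  rw [Finsupp.add_apply, Finsupp.add_apply, this, hn, Nat.prime_two.factorization_self] at h'
  omega

theorem exists_conj (F : Type*) [Field F] [Fintype F] (hodd : Odd (Fintype.card F))
   (h2 : (2:F) ≠ 0) (t : F) (ht : t^2 ≠ 4) : ∃ x z : F, x^2 + t*x*z+z^2 = -1 := by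
  have h4 : (4:F) ≠ 0 := by
    have : (4:F) = 2*2 := by norm_num
    rw [this]; exact mul_ne_zero h2 h2
  obtain ⟨a, b, h⟩ := FiniteField.exists_root_sum_quadratic (R := F)
    (f := Polynomial.X ^ 2 + Polynomial.C 1) (g := Polynomial.C (1 - t^2/4) * Polynomial.X ^ 2)
    (Polynomial.degree_X_pow_add_C (by norm_num) _)
    (Polynomial.degree_C_mul_X_pow 2 (by
      intro h; apply ht; field_simp at h; linear_combination -h))
    (Nat.odd_iff.1 hodd)
  refine ⟨a - t*b/2, b, ?_⟩
  simp at h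
  field_simp at h ⊢
  linear_combination h

theorem mem_F (F K : Type*) [Field F] [Fintype F] [Field K] [Algebra F K] (t : K)
    (h : t ^ Fintype.card F = t) : ∃ s : F, algebraMap F K s = t := by
  have h1 : (Polynomial.X ^ Fintype.card F - Polynomial.X : Polynomial F).roots.card =
      (Polynomial.X ^ Fintype.card F - Polynomial.X : Polynomial F).natDegree := by
    rw [FiniteField.roots_X_pow_card_sub_X,
      FiniteField.X_pow_card_sub_X_natDegree_eq F Fintype.one_lt_card]
    rfl
  have h2 := Polynomial.roots_map_of_injective_of_card_eq_natDegree
    (algebraMap F K).injective h1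
  have : t ∈ ((Polynomial.X ^ Fintype.card F - Polynomial.X : Polynomial F).map
      (algebraMap F K)).roots := by
    rw [Polynomial.mem_roots']
    refine ⟨?_, ?_⟩
    · simp only [Polynomial.map_sub, Polynomial.map_pow, Polynomial.map_X]
      exact FiniteField.X_pow_card_sub_X_ne_zero K Fintype.one_lt_card
    · simp [h]
  rw [← h2, Multiset.mem_map] at this
  obtain ⟨s, _, hs⟩ := this
  exact ⟨s, hs⟩

theorem two_split (q n : ℕ) (hq : Odd q) (h1 : 1 < q) (hn : (q^2-1).factorization 2 = n) :
    3 ≤ n ∧ (2^(n-1) ∣ q - 1 ∨ 2^(n-1) ∣ q + 1) := by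
  obtain ⟨r, rfl⟩ := hq
  have e : (2*r+1)^2 - 1 = 4*(r*(r+1)) := by
    rw [Nat.sub_eq_iff_eq_add (Nat.one_le_pow _ _ (by omega))]; ring
  have hr : 0 < r := by omega
  have hne : 4*(r*(r+1)) ≠ 0 := by positivity
  rw [e] at hn
  have h3 : 3 ≤ n := by
    rw [← hn, ← Nat.prime_two.pow_dvd_iff_le_factorization hne]
    obtain ⟨s, hs⟩ := even_iff_two_dvd.1 (Nat.even_mul_succ_self r)
    exact ⟨s, by rw [hs]; ring⟩
  refine ⟨h3, ?_⟩
  have hd : 2^n ∣ 4*(r*(r+1)) := (Nat.prime_two.pow_dvd_iff_le_factorization hne).2 hn.ge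
  obtain ⟨m, rfl⟩ : ∃ m, n = m + 2 := ⟨n-2, by omega⟩
  have hd' : 2^m ∣ r*(r+1) := by
    rw [pow_add, mul_comm] at hd
    exact Nat.dvd_of_mul_dvd_mul_left (by norm_num) hd
  have e2 : 2^(m+2-1) = 2*2^m := by
    rw [show m+2-1 = m+1 by omega]; ring
  rw [e2]
  rcases Nat.even_or_odd r with he | ho
  · left
    rw [show 2*r+1-1 = 2*r by omega]
    apply mul_dvd_mul_left
    refine Nat.Coprime.dvd_of_dvd_mul_right ?_ hd'
    apply Nat.Coprime.pow_left
    rw [Nat.coprime_two_left]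
    exact he.add_one
  · right
    rw [show 2*r+1+1 = 2*(r+1) by ring]
    apply mul_dvd_mul_left
    refine Nat.Coprime.dvd_of_dvd_mul_left ?_ hd'
    apply Nat.Coprime.pow_left
    rwa [Nat.coprime_two_left]

theorem exists_zeta (F : Type*) [Field F] [Fintype F] (h2 : (2:F) ≠ 0) (N : ℕ)
    (hd : 2^N ∣ Fintype.card F - 1 ∨ 2^N ∣ Fintype.card F + 1) :
    ∃ (ζ : AlgebraicClosure F) (t : F), IsPrimitiveRoot ζ (2^N) ∧
      algebraMap F (AlgebraicClosure F) t = ζ + ζ⁻¹ := by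
  have h2' : (2 : AlgebraicClosure F) ≠ 0 := by
    intro h
    apply h2
    apply (algebraMap F (AlgebraicClosure F)).injective
    simpa only [map_ofNat, map_zero] using h
  have : NeZero (((2^N : ℕ)) : AlgebraicClosure F) := ⟨by push_cast; exact pow_ne_zero _ h2'⟩
  obtain ⟨ζ, hζ⟩ := HasEnoughRootsOfUnity.exists_primitiveRoot (AlgebraicClosure F) (2^N)
  have hz : ζ ≠ 0 := hζ.ne_zero (by positivity)
  obtain ⟨p, hp⟩ := CharP.exists F
  have : CharP (AlgebraicClosure F) p := charP_of_injective_algebraMap (algebraMap F _).injective p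
  obtain ⟨k, hpp, hk⟩ := FiniteField.card F p
  have : Fact p.Prime := ⟨hpp⟩
  have key : (ζ + ζ⁻¹) ^ Fintype.card F = ζ + ζ⁻¹ := by
    have hadd : (ζ + ζ⁻¹) ^ Fintype.card F = ζ ^ Fintype.card F + ζ⁻¹ ^ Fintype.card F := by
      rw [hk]; exact add_pow_char_pow _ _ _ _
    rw [hadd, inv_pow]
    rcases hd with hd | hd
    · have h := (hζ.pow_eq_one_iff_dvd _).2 hd
      have : ζ ^ Fintype.card F = ζ := by
        rw [show Fintype.card F = Fintype.card F - 1 + 1 from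
          (Nat.sub_add_cancel Fintype.card_pos).symm, pow_succ, h, one_mul]
      rw [this]
    · have h := (hζ.pow_eq_one_iff_dvd _).2 hd
      rw [pow_succ] at h
      have : ζ ^ Fintype.card F = ζ⁻¹ := eq_inv_of_mul_eq_one_left h
      rw [this, inv_inv, add_comm]
  obtain ⟨t, ht⟩ := mem_F F _ _ key
  exact ⟨ζ, t, hζ, ht⟩

theorem pow_eig {F K : Type*} [Field F] [DecidableEq F] [Field K] [Algebra F K] (t : F) (ζ w : K)
    (h1 : algebraMap F K t = ζ + w) (h2 : ζ * w = 1) (a : Matrix.SpecialLinearGroup (Fin 2) F)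
    (ha : (a : Matrix (Fin 2) (Fin 2) F) = !![0, -1; 1, t]) (m : ℕ) :
    algebraMap F K ((a ^ m) 0 0) - ζ * algebraMap F K ((a ^ m) 0 1) = ζ ^ m ∧
    algebraMap F K ((a ^ m) 1 0) - ζ * algebraMap F K ((a ^ m) 1 1) = - ζ * ζ ^ m := by
  induction m with
  | zero => simp
  | succ m ih =>
    obtain ⟨i1, i2⟩ := ih
    have e : ∀ i, (a ^ (m+1)) i 0 = (a^m) i 1 ∧
        (a ^ (m+1)) i 1 = - (a^m) i 0 + t * (a^m) i 1 := by
      intro i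
      rw [pow_succ, Matrix.SpecialLinearGroup.coe_mul, ha]
      simp [Matrix.mul_apply, Fin.sum_univ_two, mul_comm]
    rw [(e 0).1, (e 0).2, (e 1).1, (e 1).2]
    simp only [map_add, map_neg, map_mul, h1]
    constructor
    · rw [pow_succ]
      linear_combination ζ * i1 - (algebraMap F K ((a^m) 0 1)) * h2
    · rw [pow_succ]
      linear_combination ζ * i2 - (algebraMap F K ((a^m) 1 1)) * h2

theorem exists_embed (F : Type*) [Field F] [Fintype F] [DecidableEq F] (h2 : (2:F) ≠ 0)
    (hodd : Odd (Fintype.card F)) (N : ℕ) (hN : 1 ≤ N)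
    (hd : 2^(N+1) ∣ Fintype.card F - 1 ∨ 2^(N+1) ∣ Fintype.card F + 1) :
    ∃ f : DihedralGroup (2^N) →* (Matrix.SpecialLinearGroup (Fin 2) F ⧸
      Subgroup.center (Matrix.SpecialLinearGroup (Fin 2) F)), Function.Injective f := by
  obtain ⟨ζ, t, hζ, ht⟩ := exists_zeta F h2 (N+1) hd
  have hz : ζ ≠ 0 := hζ.ne_zero (by positivity)
  have hzi : ζ * ζ⁻¹ = 1 := mul_inv_cancel₀ hz
  have hz2 : ζ ^ 2 ≠ 1 := by
    intro h
    have h := (hζ.pow_eq_one_iff_dvd _).1 h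
    have := Nat.le_of_dvd (by norm_num) h
    have : 2^2 ≤ 2^(N+1) := Nat.pow_le_pow_right (by norm_num) (by omega)
    omega
  have hzne : ζ - ζ⁻¹ ≠ 0 := by
    intro h
    apply hz2
    linear_combination ζ * h + hzi
  have ht4 : t ^ 2 ≠ 4 := by
    intro h
    have h' := congrArg (algebraMap F (AlgebraicClosure F)) h
    rw [map_pow, ht, map_ofNat] at h'
    apply pow_ne_zero 2 hzne
    linear_combination h' - 4 * hzi
  obtain ⟨x, z, hxz⟩ := exists_conj F hodd h2 t ht4
  let a : Matrix.SpecialLinearGroup (Fin 2) F := ⟨!![0, -1; 1, t], by simp [Matrix.det_fin_two]⟩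
  let b : Matrix.SpecialLinearGroup (Fin 2) F := ⟨!![x, z + x * t; z, -x], by
    rw [Matrix.det_fin_two_of]; linear_combination -hxz⟩
  have ha : (a : Matrix (Fin 2) (Fin 2) F) = !![0, -1; 1, t] := rfl
  have hb : (b : Matrix (Fin 2) (Fin 2) F) = !![x, z + x * t; z, -x] := rfl
  clear_value a b
  have eig1 := pow_eig t ζ ζ⁻¹ ht hzi a ha
  have eig2 := pow_eig t ζ⁻¹ ζ (by rw [ht, add_comm]) (by rw [mul_comm, hzi]) a ha
  have hbb : b * b = -1 := by
    ext i j
    rw [Matrix.SpecialLinearGroup.coe_mul, Matrix.SpecialLinearGroup.coe_neg, Matrix.SpecialLinearGroup.coe_one, hb]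
    fin_cases i <;> fin_cases j <;> simp [Matrix.mul_apply, Fin.sum_univ_two] <;>
      first | linear_combination hxz | ring
  have hbaba : (b * a) * (b * a) = -1 := by
    ext i j
    simp only [Matrix.SpecialLinearGroup.coe_mul, Matrix.SpecialLinearGroup.coe_neg, Matrix.SpecialLinearGroup.coe_one, ha, hb]
    fin_cases i <;> fin_cases j <;> simp [Matrix.mul_apply, Fin.sum_univ_two] <;>
      first | linear_combination hxz | ring
  have hm1 : (-1 : Matrix.SpecialLinearGroup (Fin 2) F) ∈ Subgroup.center _ := by
    rw [Subgroup.mem_center_iff]; intro g; simp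
  let α := (QuotientGroup.mk' (Subgroup.center (Matrix.SpecialLinearGroup (Fin 2) F))) a
  let β := (QuotientGroup.mk' (Subgroup.center (Matrix.SpecialLinearGroup (Fin 2) F))) b
  have hker : ∀ g : Matrix.SpecialLinearGroup (Fin 2) F,
      (QuotientGroup.mk' (Subgroup.center (Matrix.SpecialLinearGroup (Fin 2) F))) g = 1 ↔
        g ∈ Subgroup.center (Matrix.SpecialLinearGroup (Fin 2) F) :=
    fun g => QuotientGroup.eq_one_iff g
  refine dihedral_embed (2^N) α β ?_ ?_ ?_ ?_
  · apply Nat.dvd_antisymm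
    · apply orderOf_dvd_of_pow_eq_one
      rw [← map_pow, hker]
      have hz1 : ζ ^ (2^N) = -1 := by
        have h : (ζ ^ (2^N) - 1) * (ζ ^ (2^N) + 1) = 0 := by
          have := hζ.pow_eq_one
          rw [pow_succ, pow_mul] at this
          linear_combination this
        rcases mul_eq_zero.1 h with h | h
        · have h := (hζ.pow_eq_one_iff_dvd _).1 (sub_eq_zero.1 h)
          have := Nat.le_of_dvd (by positivity) h
          rw [pow_succ] at this
          have : 0 < 2^N := by positivity
          omega
        · exact eq_neg_of_add_eq_zero_left h
      obtain ⟨p1, p2⟩ := eig1 (2^N)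
      obtain ⟨p3, p4⟩ := eig2 (2^N)
      rw [inv_pow, hz1] at p3 p4
      rw [hz1] at p1 p2
      have inj := (algebraMap F (AlgebraicClosure F)).injective
      have q1 : (a ^ (2^N)) 0 1 = 0 := by
        apply inj
        rw [map_zero]
        apply (mul_eq_zero.1 (_ : (ζ - ζ⁻¹) * _ = 0)).resolve_left hzne
        rw [inv_neg, inv_one] at p3
        linear_combination p3 - p1
      have q2 : (a ^ (2^N)) 0 0 = -1 := by
        apply inj
        rw [q1] at p1
        simpa using p1
      have q3 : (a ^ (2^N)) 1 1 = -1 := by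
        apply inj
        rw [inv_neg, inv_one] at p4
        rw [map_neg, map_one]
        apply mul_left_cancel₀ hzne
        linear_combination p4 - p2
      have q4 : (a ^ (2^N)) 1 0 = 0 := by
        apply inj
        rw [q3] at p2
        simp only [map_neg, map_one] at p2
        rw [map_zero]
        linear_combination p2
      have : a ^ (2^N) = -1 := by
        ext i j
        rw [Matrix.SpecialLinearGroup.coe_neg, Matrix.SpecialLinearGroup.coe_one]
        fin_cases i <;> fin_cases j
        · simpa using q2
        · simpa using q1
        · simpa using q4
        · simpa using q3
      rw [this]; exact hm1
    · have h := pow_orderOf_eq_one α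
      rw [← map_pow, hker] at h
      generalize orderOf α = m at h
      obtain ⟨r, hr, hr'⟩ := Matrix.SpecialLinearGroup.mem_center_iff.1 h
      have p := (eig1 m).1
      have e0 : (a^m) 0 0 = r := by rw [← hr']; simp
      have e1 : (a^m) 0 1 = 0 := by rw [← hr']; simp
      rw [e0, e1, map_zero, mul_zero, sub_zero] at p
      have : ζ ^ (m * 2) = 1 := by
        rw [pow_mul, ← p, ← map_pow]
        rw [Fintype.card_fin] at hr
        rw [hr, map_one]
      have := (hζ.pow_eq_one_iff_dvd _).1 this
      rw [pow_succ] at this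
      exact Nat.dvd_of_mul_dvd_mul_right (by norm_num) this
  · rw [← map_mul, hker, hbb]; exact hm1
  · apply eq_inv_of_mul_eq_one_left
    rw [← map_mul, ← map_mul, ← map_mul, hker, mul_assoc (b * a), hbaba]; exact hm1
  · intro m h
    rw [← map_zpow, ← map_mul, hker] at h
    have hc := Subgroup.mem_center_iff.1 h a
    have hc2 : a * b = b * a := by
      have hc' : a * b * a ^ m = b * a * a ^ m := by
        rw [mul_assoc, hc, mul_assoc, mul_assoc, (Commute.refl a).zpow_left m |>.eq]
      exact mul_right_cancel hc'
    have haa : a ^ 2 = 1 := by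
      have : b * b * (a ^ 2) = b * b * 1 := by
        calc b * b * (a ^ 2) = b * (b * a) * a := by rw [pow_two]; simp only [mul_assoc]
          _ = (b * a) * (b * a) := by nth_rw 1 [← hc2]; simp only [mul_assoc]
          _ = b * b * 1 := by rw [hbaba, hbb, mul_one]
      exact mul_left_cancel this
    have p := (eig1 2).1
    rw [haa] at p
    apply hz2
    rw [← p]; simp


end PSLDih

open PSLDih

/-- Let `q` be an odd prime power. A Sylow 2-subgroup of `PSL_2(q)` is dihedral of order
`(q²-1)_2 / 2`. -/
theorem stmt13 (p k : ℕ) (hp : p.Prime) (hpodd : Odd p) (hk : 0 < k)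
    (q : ℕ) (hq : q = p ^ k)
    (F : Type*) [Field F] [Fintype F] [DecidableEq F] (hF : Fintype.card F = q)
    (P : Sylow 2 (Matrix.SpecialLinearGroup (Fin 2) F ⧸
      Subgroup.center (Matrix.SpecialLinearGroup (Fin 2) F))) :
    Nat.card (P : Subgroup (Matrix.SpecialLinearGroup (Fin 2) F ⧸
        Subgroup.center (Matrix.SpecialLinearGroup (Fin 2) F))) =
      2 ^ ((q ^ 2 - 1).factorization 2) / 2 ∧
    Nonempty ((P : Subgroup (Matrix.SpecialLinearGroup (Fin 2) F ⧸
        Subgroup.center (Matrix.SpecialLinearGroup (Fin 2) F))) ≃*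
      DihedralGroup (2 ^ ((q ^ 2 - 1).factorization 2 - 2))) := by
  have hodd : Odd (Fintype.card F) := by rw [hF, hq]; exact hpodd.pow
  have h2 : (2:F) ≠ 0 := by
    intro h
    have hc : ((Fintype.card F : ℕ) : F) = 0 := FiniteField.cast_card_eq_zero F
    obtain ⟨r, hr⟩ := hodd
    rw [hr] at hc
    push_cast at hc
    rw [h] at hc
    simp at hc
  have h1 : 1 < q := hF ▸ Fintype.one_lt_card
  subst hF
  obtain ⟨n, hn⟩ : ∃ n, (Fintype.card F ^ 2 - 1).factorization 2 = n := ⟨_, rfl⟩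
  obtain ⟨h3, hd⟩ := two_split _ n hodd h1 hn
  have hcard := card_PSL2 F h2 hodd n hn
  rw [hn]
  obtain ⟨m, rfl⟩ : ∃ m, n = m + 2 := ⟨n - 2, by omega⟩
  have e1 : m + 2 - 1 = m + 1 := by omega
  rw [e1] at hd hcard
  rw [show m + 2 - 2 = m by omega]
  obtain ⟨f, hf⟩ := exists_embed F h2 hodd m (by omega) hd
  have : Fact (Nat.Prime 2) := ⟨Nat.prime_two⟩
  constructor
  · rw [P.card_eq_multiplicity, hcard, pow_succ 2 (m+1), Nat.mul_div_cancel _ (by norm_num)]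
  · let e := MonoidHom.ofInjective hf
    have hr : Nat.card f.range = 2 ^ (Nat.card (Matrix.SpecialLinearGroup (Fin 2) F ⧸
        Subgroup.center (Matrix.SpecialLinearGroup (Fin 2) F))).factorization 2 := by
      rw [← Nat.card_congr e.toEquiv, DihedralGroup.nat_card, hcard, pow_succ, mul_comm]
    let Q := Sylow.ofCard f.range hr
    exact ⟨(P.equiv Q).trans e.symm⟩
end
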